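/- There exists a finite constant C such that for all integers 0 ≤ k < h, if the chain Z starts at k then E[τ_h²] < C·h². -/

import Mathlib

open MeasureTheory ProbabilityTheory
open scoped ENNReal

/-- ρ(i,j) := 2^{−i−j−1}·(i+j)!/(i!·j!). -/
noncomputable def rho (i j : ℕ) : ℝ :=
  (2 : ℝ) ^ (-(i : ℝ) - (j : ℝ) - 1) * (Nat.factorial (i + j)) /
    ((Nat.factorial i) * (Nat.factorial j))

/-- `Z` is a Markov chain with transition probabilities `trans` started at `k`:
`P(Z_0 = k) = 1` and
`P(Z_0 = k_0, …, Z_n = k_n) = P(Z_0 = k_0) · ∏_{0 ≤ i < n} trans(k_i, k_{i+1})`. -/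
def IsMarkovChainFrom {Ω : Type*} [MeasurableSpace Ω] (P : Measure Ω)
    (Z : ℕ → Ω → ℕ) (trans : ℕ → ℕ → ℝ) (k : ℕ) : Prop :=
  (∀ t, Measurable (Z t)) ∧
    ∀ (n : ℕ) (ks : ℕ → ℕ),
      P {ω | ∀ i ≤ n, Z i ω = ks i} =
        ENNReal.ofReal ((if ks 0 = k then 1 else 0) *
          ∏ i ∈ Finset.range n, trans (ks i) (ks (i + 1)))

/-- `τ_h := inf{t ≥ 0 : Z_t ≥ h}` (with value `∞` if there is no such `t`). -/
noncomputable def tau {Ω : Type*} (Z : ℕ → Ω → ℕ) (h : ℕ) (ω : Ω) : ℕ∞ :=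
  sInf ((↑) '' {t : ℕ | h ≤ Z t ω} : Set ℕ∞)

lemma rho_eq_choose (i j : ℕ) :
    rho i j = (1 / 2 : ℝ) ^ (i + 1) * (((j + i).choose i : ℝ) * (1 / 2) ^ j) := by
  have h2 : (2 : ℝ) ^ (-(i : ℝ) - (j : ℝ) - 1) = (1 / 2 : ℝ) ^ (i + 1) * (1 / 2) ^ j := by
    rw [← pow_add, one_div, inv_pow, ← Real.rpow_natCast, ← Real.rpow_neg (by norm_num)]
    congr 1
    push_cast
    ring
  rw [rho, h2, Nat.add_choose, Nat.cast_div (Nat.factorial_mul_factorial_dvd_factorial_add j i)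
    (by positivity), add_comm i j]
  push_cast
  field_simp

lemma rho_nonneg (i j : ℕ) : 0 ≤ rho i j := by
  rw [rho_eq_choose]
  positivity

/-- The generating function of `rho i` is `s ↦ (2 - s)⁻¹ ^ (i + 1)`. -/
lemma hasSum_rho_mul_pow (i : ℕ) {s : ℝ} (hs0 : 0 ≤ s) (hs : s < 2) :
    HasSum (fun j => rho i j * s ^ j) ((2 - s)⁻¹ ^ (i + 1)) := by
  have hr : ‖s / 2‖ < 1 := by
    rw [Real.norm_of_nonneg (by positivity)]
    linarith
  have key := (hasSum_choose_mul_geometric_of_norm_lt_one i hr).mul_left ((1 / 2 : ℝ) ^ (i + 1))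
  have hfun : (fun j => rho i j * s ^ j) =
      fun j => (1 / 2 : ℝ) ^ (i + 1) * (((j + i).choose i : ℝ) * (s / 2) ^ j) := by
    funext j
    rw [rho_eq_choose, div_eq_mul_one_div s, mul_pow s]
    ring
  have hval : (2 - s)⁻¹ ^ (i + 1) = (1 / 2 : ℝ) ^ (i + 1) * (1 / (1 - s / 2) ^ (i + 1)) := by
    rw [one_div_pow, one_div_mul_one_div, ← mul_pow, inv_pow, one_div]
    congr 2
    ring
  rwa [hfun, hval]

lemma sum_range_rho_mul_pow_le {h i : ℕ} (hi : i < h) :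
    ∑ j ∈ Finset.range h, rho i j * (2 * h / (2 * h + 1) : ℝ) ^ j ≤
      (1 - 1 / (8 * h)) * (2 * h / (2 * h + 1) : ℝ) ^ i := by
  have h1 : (1 : ℝ) ≤ h := by exact_mod_cast (by omega : 1 ≤ h)
  have hi' : (i : ℝ) ≤ h := by exact_mod_cast hi.le
  set s : ℝ := 2 * h / (2 * h + 1) with hs
  set a : ℝ := (2 * h + 1) / (2 * h + 2) with ha
  have hs0 : 0 ≤ s := by positivity
  have hs1 : s < 2 := by
    rw [hs, div_lt_iff₀ (by positivity)]
    linarith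
  have ha0 : 0 ≤ a := by positivity
  have hsum : ∑ j ∈ Finset.range h, rho i j * s ^ j ≤ a ^ (i + 1) := by
    have hinv : (2 - s)⁻¹ = a := by
      rw [hs, ha, inv_eq_iff_eq_inv, inv_div]
      field_simp
      ring
    rw [← hinv]
    exact sum_le_hasSum _ (fun j _ => mul_nonneg (rho_nonneg i j) (pow_nonneg hs0 j))
      (hasSum_rho_mul_pow i hs0 hs1)
  have hsa : s = a * (1 + -(1 / (2 * h + 1) ^ 2)) := by
    rw [hs, ha]
    field_simp
    ring
  have hsq : (1 : ℝ) / (2 * h + 1) ^ 2 ≤ 1 := by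
    rw [div_le_one (by positivity)]
    nlinarith
  have hbern : 1 - h * (1 / (2 * h + 1) ^ 2 : ℝ) ≤ (1 + -(1 / (2 * h + 1) ^ 2 : ℝ)) ^ i := by
    refine le_trans ?_ (one_add_mul_le_pow (by linarith) i)
    have : (0 : ℝ) ≤ 1 / (2 * h + 1) ^ 2 := by positivity
    nlinarith
  have hfac : (0 : ℝ) ≤ 1 - 1 / (8 * h) := by
    rw [sub_nonneg, div_le_one (by positivity)]
    linarith
  have hale : a ≤ (1 - 1 / (8 * h)) * (1 - h * (1 / (2 * h + 1) ^ 2 : ℝ)) := by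
    have hdiff : (1 - 1 / (8 * h)) * (1 - h * (1 / (2 * h + 1) ^ 2 : ℝ)) - a =
        (8 * h ^ 3 + 2 * h ^ 2 - 2) / (8 * h * (2 * h + 1) ^ 2 * (2 * h + 2)) := by
      rw [ha]
      field_simp
      ring
    have hnum : (0 : ℝ) ≤ 8 * h ^ 3 + 2 * h ^ 2 - 2 := by
      have : (1 : ℝ) ≤ h ^ 2 := one_le_pow₀ h1
      have : (0 : ℝ) ≤ h ^ 3 := by positivity
      linarith
    rw [← sub_nonneg, hdiff]
    positivity
  calc ∑ j ∈ Finset.range h, rho i j * s ^ j ≤ a ^ i * a := by rwa [← pow_succ]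
    _ ≤ a ^ i * ((1 - 1 / (8 * h)) * (1 + -(1 / (2 * h + 1) ^ 2 : ℝ)) ^ i) := by
        gcongr
        exact hale.trans (by gcongr)
    _ = (1 - 1 / (8 * h)) * s ^ i := by
        rw [hsa, mul_pow]
        ring

lemma one_le_two_mul_pow {h i : ℕ} (hi : i < h) :
    1 ≤ 2 * (2 * h / (2 * h + 1) : ℝ) ^ i := by
  have hi' : (i : ℝ) ≤ h := by exact_mod_cast hi.le
  have heq : (2 * h / (2 * h + 1) : ℝ) = 1 + -(1 / (2 * h + 1)) := by
    field_simp
    ring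
  have hle : (1 : ℝ) / (2 * h + 1) ≤ 1 := by
    rw [div_le_one (by positivity)]
    linarith [(Nat.cast_nonneg h : (0 : ℝ) ≤ h)]
  have hbern := one_add_mul_le_pow (a := -(1 / (2 * h + 1) : ℝ)) (by linarith) i
  have hi2 : i * (1 / (2 * h + 1) : ℝ) ≤ 1 / 2 := by
    rw [mul_one_div, div_le_div_iff₀ (by positivity) (by positivity)]
    linarith
  rw [heq]
  linarith

section Chain

variable {Ω : Type*} [MeasurableSpace Ω] {P : Measure Ω} {Z : ℕ → Ω → ℕ} {k : ℕ}

lemma IsMarkovChainFrom.measure_prefix_succ {trans : ℕ → ℕ → ℝ}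
    (hZ : IsMarkovChainFrom P Z trans k) (htrans : ∀ i j, 0 ≤ trans i j) (n : ℕ) (ks : ℕ → ℕ)
    (j : ℕ) :
    P {ω | ∀ i ≤ n + 1, Z i ω = Function.update ks (n + 1) j i} =
      P {ω | ∀ i ≤ n, Z i ω = ks i} * ENNReal.ofReal (trans (ks n) j) := by
  have hprod : ∏ i ∈ Finset.range n, trans (Function.update ks (n + 1) j i)
      (Function.update ks (n + 1) j (i + 1)) = ∏ i ∈ Finset.range n, trans (ks i) (ks (i + 1)) := by
    refine Finset.prod_congr rfl fun i hi => ?_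
    have hin := Finset.mem_range.1 hi
    rw [Function.update_of_ne (by omega), Function.update_of_ne (by omega)]
  rw [hZ.2, hZ.2, Finset.prod_range_succ, hprod, Function.update_self,
    Function.update_of_ne (by omega), Function.update_of_ne (by omega), ← mul_assoc,
    ENNReal.ofReal_mul]
  exact mul_nonneg (by split_ifs <;> norm_num) (Finset.prod_nonneg fun i _ => htrans _ _)

/-- Given a prefix of the path, the probability to stay below `h` for `m` more steps decays
geometrically in `m`. -/
lemma IsMarkovChainFrom.measure_prefix_stay_le (hZ : IsMarkovChainFrom P Z rho k) {h : ℕ} (m : ℕ) :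
    ∀ (n : ℕ) (ks : ℕ → ℕ), ks n < h →
      P {ω | (∀ i ≤ n, Z i ω = ks i) ∧ ∀ i ≤ n + m, n < i → Z i ω < h} ≤
        P {ω | ∀ i ≤ n, Z i ω = ks i} *
          ENNReal.ofReal (2 * (1 - 1 / (8 * h)) ^ m * (2 * h / (2 * h + 1) : ℝ) ^ ks n) := by
  induction m with
  | zero =>
    intro n ks hk
    calc _ ≤ P {ω | ∀ i ≤ n, Z i ω = ks i} * 1 := by
          rw [mul_one]
          exact measure_mono fun ω hω => hω.1
      _ ≤ _ := by
          gcongr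
          rw [pow_zero, mul_one, ENNReal.one_le_ofReal]
          exact one_le_two_mul_pow hk
  | succ m ih =>
    intro n ks hk
    have h1 : (1 : ℝ) ≤ h := by exact_mod_cast (by omega : 1 ≤ h)
    have hfac : (0 : ℝ) ≤ 1 - 1 / (8 * h) := by
      rw [sub_nonneg, div_le_one (by positivity)]
      linarith
    have hsub : {ω | (∀ i ≤ n, Z i ω = ks i) ∧ ∀ i ≤ n + (m + 1), n < i → Z i ω < h} ⊆
        ⋃ j ∈ Finset.range h, {ω | (∀ i ≤ n + 1, Z i ω = Function.update ks (n + 1) j i) ∧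
          ∀ i ≤ n + 1 + m, n + 1 < i → Z i ω < h} := by
      rintro ω ⟨hω, hω'⟩
      simp only [Set.mem_iUnion, Finset.mem_range]
      refine ⟨Z (n + 1) ω, hω' (n + 1) (by omega) (by omega), fun i hi => ?_,
        fun i hi hi' => hω' i (by omega) (by omega)⟩
      rcases eq_or_ne i (n + 1) with rfl | hne
      · rw [Function.update_self]
      · rw [Function.update_of_ne hne]
        exact hω i (by omega)
    refine (measure_mono hsub).trans ((measure_biUnion_finset_le _ _).trans ?_)
    calc _ ≤ ∑ j ∈ Finset.range h, P {ω | ∀ i ≤ n, Z i ω = ks i} *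
            ENNReal.ofReal (2 * (1 - 1 / (8 * h)) ^ m *
              (rho (ks n) j * (2 * h / (2 * h + 1) : ℝ) ^ j)) := by
          refine Finset.sum_le_sum fun j hj => ?_
          refine (ih (n + 1) (Function.update ks (n + 1) j) ?_).trans_eq ?_
          · simpa using hj
          · rw [hZ.measure_prefix_succ rho_nonneg, Function.update_self, mul_assoc,
              ← ENNReal.ofReal_mul (rho_nonneg _ _)]
            congr 2
            ring
      _ = P {ω | ∀ i ≤ n, Z i ω = ks i} * ENNReal.ofReal (2 * (1 - 1 / (8 * h)) ^ m *
            ∑ j ∈ Finset.range h, rho (ks n) j * (2 * h / (2 * h + 1) : ℝ) ^ j) := by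
          rw [← Finset.mul_sum, Finset.mul_sum (a := _ * _), ENNReal.ofReal_sum_of_nonneg]
          intro j _
          have := rho_nonneg (ks n) j
          positivity
      _ ≤ _ := by
          refine mul_le_mul_right (ENNReal.ofReal_le_ofReal ?_) _
          calc _ ≤ 2 * (1 - 1 / (8 * h)) ^ m *
                ((1 - 1 / (8 * h)) * (2 * h / (2 * h + 1) : ℝ) ^ ks n) := by
                exact mul_le_mul_of_nonneg_left (sum_range_rho_mul_pow_le hk) (by positivity)
            _ = _ := by ring

lemma IsMarkovChainFrom.measure_stay_le [IsProbabilityMeasure P]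
    (hZ : IsMarkovChainFrom P Z rho k) {h : ℕ} (hk : k < h) (m : ℕ) :
    P {ω | ∀ i ≤ m, Z i ω < h} ≤ ENNReal.ofReal (2 * (1 - 1 / (8 * h)) ^ m) := by
  have h1 : (1 : ℝ) ≤ h := by exact_mod_cast (by omega : 1 ≤ h)
  have hfac : (0 : ℝ) ≤ 1 - 1 / (8 * h) := by
    rw [sub_nonneg, div_le_one (by positivity)]
    linarith
  have hstart : P {ω | Z 0 ω = k}ᶜ = 0 := by
    have hmeas : MeasurableSet {ω | Z 0 ω = k} := hZ.1 0 (measurableSet_singleton k)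
    rw [prob_compl_eq_zero_iff hmeas]
    simpa using hZ.2 0 fun _ => k
  have hsub : {ω | ∀ i ≤ m, Z i ω < h} ⊆
      {ω | (∀ i ≤ 0, Z i ω = k) ∧ ∀ i ≤ 0 + m, 0 < i → Z i ω < h} ∪ {ω | Z 0 ω = k}ᶜ := by
    intro ω hω
    by_cases h0 : Z 0 ω = k
    · refine Or.inl ⟨fun i hi => ?_, fun i hi _ => hω i (by omega)⟩
      rwa [Nat.le_zero.1 hi]
    · exact Or.inr h0
  calc _ ≤ P {ω | (∀ i ≤ 0, Z i ω = k) ∧ ∀ i ≤ 0 + m, 0 < i → Z i ω < h} +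
        P {ω | Z 0 ω = k}ᶜ := (measure_mono hsub).trans (measure_union_le _ _)
    _ ≤ 1 * ENNReal.ofReal (2 * (1 - 1 / (8 * h)) ^ m) := by
        rw [hstart, add_zero]
        refine (hZ.measure_prefix_stay_le m 0 (fun _ => k) hk).trans ?_
        refine mul_le_mul' prob_le_one (ENNReal.ofReal_le_ofReal ?_)
        refine mul_le_of_le_one_right (by positivity) (pow_le_one₀ (by positivity) ?_)
        rw [div_le_one (by positivity)]
        linarith
    _ = _ := one_mul _

end Chain

lemma lt_tau_iff {Ω : Type*} (Z : ℕ → Ω → ℕ) (h n : ℕ) (ω : Ω) :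
    (n : ℕ∞) < tau Z h ω ↔ ∀ i ≤ n, Z i ω < h := by
  constructor
  · intro hlt i hi
    by_contra! hge
    have hle : tau Z h ω ≤ (i : ℕ∞) := sInf_le ⟨i, hge, rfl⟩
    exact absurd (hlt.trans_le hle) (by simpa using hi)
  · intro hall
    refine (ENat.natCast_lt_natCast.2 n.lt_succ_self).trans_le (le_sInf ?_)
    rintro _ ⟨i, hi, rfl⟩
    by_contra! hlt
    have := hall i (by have := ENat.natCast_lt_natCast.1 hlt; omega)
    exact absurd hi (by simpa using this)

lemma ENat.toENNReal_sq_le_tsum (t : ℕ∞) :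
    (t : ℝ≥0∞) ^ 2 ≤ ∑' n : ℕ, if (n : ℕ∞) < t then (2 * n + 1 : ℝ≥0∞) else 0 := by
  induction t with
  | top =>
    have hone : ∑' _ : ℕ, (1 : ℝ≥0∞) = ⊤ := ENNReal.tsum_const_eq_top_of_ne_zero one_ne_zero
    refine le_top.trans (hone.symm.le.trans (ENNReal.tsum_le_tsum fun n => ?_))
    rw [if_pos (ENat.natCast_lt_top n)]
    exact le_add_self
  | coe t =>
    refine le_trans (le_of_eq ?_) (ENNReal.sum_le_tsum (Finset.range t))
    have hsum : ∀ t : ℕ, ∑ n ∈ Finset.range t, (2 * n + 1) = t ^ 2 := by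
      intro t
      induction t with
      | zero => rfl
      | succ t ih => rw [Finset.sum_range_succ, ih]; ring
    calc ((t : ℕ∞) : ℝ≥0∞) ^ 2 = ((∑ n ∈ Finset.range t, (2 * n + 1) : ℕ) : ℝ≥0∞) := by
          rw [hsum]
          simp
      _ = ∑ n ∈ Finset.range t, (2 * n + 1 : ℝ≥0∞) := by push_cast; rfl
      _ = _ := by
          refine Finset.sum_congr rfl fun n hn => ?_
          rw [if_pos (ENat.natCast_lt_natCast.2 (Finset.mem_range.1 hn))]

lemma tsum_odd_mul_geometric_le {r : ℝ} (hr0 : 0 ≤ r) (hr1 : r < 1) :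
    ∑' n : ℕ, (2 * n + 1 : ℝ≥0∞) * ENNReal.ofReal (2 * r ^ n) ≤
      ENNReal.ofReal (4 / (1 - r) ^ 2) := by
  have hr : ‖r‖ < 1 := by rwa [Real.norm_of_nonneg hr0]
  have hs := (hasSum_choose_mul_geometric_of_norm_lt_one 1 hr).mul_left 4
  rw [mul_one_div] at hs
  rw [← hs.tsum_eq, ENNReal.ofReal_tsum_of_nonneg (fun n => by positivity) hs.summable]
  refine ENNReal.tsum_le_tsum fun n => ?_
  have hcast : (2 * n + 1 : ℝ≥0∞) = ENNReal.ofReal (2 * n + 1) := by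
    rw [ENNReal.ofReal_add (by positivity) zero_le_one, ENNReal.ofReal_mul zero_le_two]
    simp
  rw [hcast, ← ENNReal.ofReal_mul (by positivity), Nat.choose_one_right]
  refine ENNReal.ofReal_le_ofReal ?_
  push_cast
  have : 0 ≤ r ^ n := pow_nonneg hr0 n
  nlinarith

/-- There exists a finite constant C such that for all integers 0 ≤ k < h, if
the chain Z starts at k then E[τ_h²] < C·h². -/
theorem stmt_18 :
    ∃ C : ℝ,
      ∀ (h k : ℕ), k < h →
        ∀ (Ω : Type) (_ : MeasurableSpace Ω) (P : Measure Ω) (Z : ℕ → Ω → ℕ),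
          IsProbabilityMeasure P → IsMarkovChainFrom P Z rho k →
          ∫⁻ ω, ((tau Z h ω : ℕ∞) : ℝ≥0∞) ^ 2 ∂P <
            ENNReal.ofReal (C * (h : ℝ) ^ 2) := by
  refine ⟨257, fun h k hk Ω _ P Z hP hZ => ?_⟩
  have h1 : (1 : ℝ) ≤ h := by exact_mod_cast (by omega : 1 ≤ h)
  have hr0 : (0 : ℝ) ≤ 1 - 1 / (8 * h) := by
    rw [sub_nonneg, div_le_one (by positivity)]
    linarith
  have hr1 : (1 - 1 / (8 * h) : ℝ) < 1 := by
    rw [sub_lt_self_iff]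
    positivity
  have hset : ∀ n : ℕ, {ω | (n : ℕ∞) < tau Z h ω} = {ω | ∀ i ≤ n, Z i ω < h} := fun n =>
    Set.ext fun ω => lt_tau_iff Z h n ω
  have hmeas : ∀ n : ℕ, MeasurableSet {ω | (n : ℕ∞) < tau Z h ω} := by
    intro n
    rw [hset]
    simp only [Set.ofPred_forall]
    exact MeasurableSet.iInter fun i => MeasurableSet.iInter fun _ => hZ.1 i measurableSet_Iio
  calc ∫⁻ ω, ((tau Z h ω : ℕ∞) : ℝ≥0∞) ^ 2 ∂P
      ≤ ∫⁻ ω, ∑' n : ℕ, {ω | (n : ℕ∞) < tau Z h ω}.indicator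
          (fun _ => (2 * n + 1 : ℝ≥0∞)) ω ∂P :=
        lintegral_mono fun ω => by
          simpa only [Set.indicator_apply, Set.mem_ofPred_eq] using
            ENat.toENNReal_sq_le_tsum (tau Z h ω)
    _ = ∑' n : ℕ, (2 * n + 1 : ℝ≥0∞) * P {ω | ∀ i ≤ n, Z i ω < h} := by
        rw [lintegral_tsum fun n => (measurable_const.indicator (hmeas n)).aemeasurable]
        refine tsum_congr fun n => ?_
        rw [lintegral_indicator_const (hmeas n), hset]
    _ ≤ ∑' n : ℕ, (2 * n + 1 : ℝ≥0∞) * ENNReal.ofReal (2 * (1 - 1 / (8 * h)) ^ n) :=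
        ENNReal.tsum_le_tsum fun n => mul_le_mul_right (hZ.measure_stay_le hk n) _
    _ ≤ ENNReal.ofReal (4 / (1 - (1 - 1 / (8 * h))) ^ 2) := tsum_odd_mul_geometric_le hr0 hr1
    _ = ENNReal.ofReal (256 * (h : ℝ) ^ 2) := by
        congr 1
        rw [sub_sub_cancel]
        field_simp
        norm_num
    _ < ENNReal.ofReal (257 * (h : ℝ) ^ 2) := by
        rw [ENNReal.ofReal_lt_ofReal_iff (by positivity)]
        nlinarith
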